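/- If 𝒳 is a compact pmm space, then the set of compact pmm-subspaces of 𝒳 is compact in the topology of the Gromov-Hausdorff-Prokhorov distance dc: every sequence of compact pmm-subspaces of 𝒳 has a subsequence converging in dc to a compact pmm-subspace of 𝒳. -/

import Mathlib

open MeasureTheory Topology Filter

noncomputable section

/-- Prokhorov distance between finite Borel measures on a metric space. -/
def prokhorovDist {Z : Type*} [MetricSpace Z] [MeasurableSpace Z]
    (μ ν : Measure Z) : ℝ :=
  sInf {ε : ℝ | 0 < ε ∧ ∀ A : Set Z, IsClosed A →
    μ A ≤ ν (Metric.cthickening ε A) + ENNReal.ofReal ε ∧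
    ν A ≤ μ (Metric.cthickening ε A) + ENNReal.ofReal ε}

/-- A pointed measured metric space: a metric space with a distinguished point and a Borel
measure. -/
structure PMM : Type 1 where
  carrier : Type
  metric : MetricSpace carrier
  basepoint : carrier
  meas : @Measure carrier
    (@borel carrier metric.toPseudoMetricSpace.toUniformSpace.toTopologicalSpace)

attribute [instance] PMM.metric

instance PMM.instMeasurableSpace (𝒳 : PMM) : MeasurableSpace 𝒳.carrier := borel 𝒳.carrier

instance PMM.instBorelSpace (𝒳 : PMM) : BorelSpace 𝒳.carrier := ⟨rfl⟩

/-- A pmm space is boundedly compact if every closed ball is compact and has finite measure. -/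
def PMM.BoundedlyCompact (𝒳 : PMM) : Prop :=
  (∀ (x : 𝒳.carrier) (r : ℝ), IsCompact (Metric.closedBall x r)) ∧
  (∀ (x : 𝒳.carrier) (r : ℝ), 𝒳.meas (Metric.closedBall x r) ≠ ⊤)

/-- A pmm space is compact if its carrier is compact and its measure is finite. -/
def PMM.IsCompactPMM (𝒳 : PMM) : Prop :=
  CompactSpace 𝒳.carrier ∧ 𝒳.meas Set.univ ≠ ⊤

/-- A pair of maps of two pmm spaces into a common metric space. -/
structure GHPEmbedding (𝒳 𝒴 : PMM) : Type 1 where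
  Z : Type
  mZ : MetricSpace Z
  f : 𝒳.carrier → Z
  g : 𝒴.carrier → Z

attribute [instance] GHPEmbedding.mZ

/-- Both maps of a `GHPEmbedding` are isometric embeddings. -/
def GHPEmbedding.IsIsometric {𝒳 𝒴 : PMM} (e : GHPEmbedding 𝒳 𝒴) : Prop :=
  Isometry e.f ∧ Isometry e.g

/-- The quantity `max(d(f o_X, g o_Y), dH(f(X), g(Y)), dP(f_*μ_X, g_*μ_Y))` associated to a
pair of embeddings into a common space. -/
def GHPEmbedding.value {𝒳 𝒴 : PMM} (e : GHPEmbedding 𝒳 𝒴) : ℝ :=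
  letI : MeasurableSpace e.Z := borel e.Z
  max (dist (e.f 𝒳.basepoint) (e.g 𝒴.basepoint))
    (max (Metric.hausdorffDist (Set.range e.f) (Set.range e.g))
      (prokhorovDist (𝒳.meas.map e.f) (𝒴.meas.map e.g)))

/-- The Gromov-Hausdorff-Prokhorov distance of compact pmm spaces. -/
def cGHP (𝒳 𝒴 : PMM) : ℝ :=
  sInf {x : ℝ | ∃ e : GHPEmbedding 𝒳 𝒴, e.IsIsometric ∧ x = e.value}

/-- A pmm-subspace of a pmm space `𝒳`: a subset containing the basepoint together with a
measure `≤ 𝒳.meas` supported on the subset. -/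
structure SubPMM (𝒳 : PMM) where
  set : Set 𝒳.carrier
  root_mem : 𝒳.basepoint ∈ set
  meas : Measure 𝒳.carrier
  meas_le : meas ≤ 𝒳.meas
  supported : meas setᶜ = 0

/-- The pmm space associated to a pmm-subspace. -/
def SubPMM.toPMM {𝒳 : PMM} (S : SubPMM 𝒳) : PMM where
  carrier := ↥S.set
  metric := inferInstance
  basepoint := ⟨𝒳.basepoint, S.root_mem⟩
  meas := @Measure.comap ↥S.set 𝒳.carrier (borel ↥S.set) inferInstance Subtype.val S.meas

/-- The pmm-subspace ordering: inclusion of sets and inequality of measures. -/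
instance {𝒳 : PMM} : LE (SubPMM 𝒳) :=
  ⟨fun S T => S.set ⊆ T.set ∧ S.meas ≤ T.meas⟩

/-- Compactness of a pmm-subspace. -/
def SubPMM.IsCompactSub {𝒳 : PMM} (S : SubPMM 𝒳) : Prop :=
  IsCompact S.set ∧ S.meas Set.univ ≠ ⊤

/-- The closed ball of radius `r` around the basepoint, as a pmm-subspace (for `r ≥ 0` the
underlying set is exactly the closed ball; the basepoint is inserted so that the definition
makes sense for all `r`). -/
def PMM.ballSub (𝒳 : PMM) (r : ℝ) : SubPMM 𝒳 where
  set := insert 𝒳.basepoint (Metric.closedBall 𝒳.basepoint r)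
  root_mem := Set.mem_insert _ _
  meas := 𝒳.meas.restrict (insert 𝒳.basepoint (Metric.closedBall 𝒳.basepoint r))
  meas_le := Measure.restrict_le_self
  supported := by
    rw [Measure.restrict_apply ((measurableSet_closedBall.insert 𝒳.basepoint).compl),
      Set.compl_inter_self]
    simp

/-- The quantity `a(ε, r; 𝒳, 𝒴)`. -/
def aFun (ε r : ℝ) (𝒳 𝒴 : PMM) : ℝ :=
  sInf {x : ℝ | ∃ Y' : SubPMM 𝒴, Y'.IsCompactSub ∧ 𝒴.ballSub (r - ε) ≤ Y' ∧
    x = cGHP ((𝒳.ballSub r).toPMM) Y'.toPMM}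

/-- The quantity `a_ε(𝒳, 𝒴) = a(ε, 1/ε; 𝒳, 𝒴)`. -/
def aEps (ε : ℝ) (𝒳 𝒴 : PMM) : ℝ := aFun ε (1 / ε) 𝒳 𝒴

/-- The Gromov-Hausdorff-Prokhorov distance of boundedly compact pmm spaces
(with `inf ∅ = 1`). -/
def GHP (𝒳 𝒴 : PMM) : ℝ :=
  sInf (insert 1 {ε : ℝ | ε ∈ Set.Ioc (0 : ℝ) 1 ∧ max (aEps ε 𝒳 𝒴) (aEps ε 𝒴 𝒳) < ε / 2})

/-- Two pmm spaces are GHP-isometric if there is a root-preserving measure-preserving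
surjective isometry between them. -/
def GHPIsometric (𝒳 𝒴 : PMM) : Prop :=
  ∃ ρ : 𝒳.carrier → 𝒴.carrier, Isometry ρ ∧ Function.Surjective ρ ∧
    ρ 𝒳.basepoint = 𝒴.basepoint ∧ 𝒳.meas.map ρ = 𝒴.meas

/-- `r` is a continuity radius of a pmm space. -/
def PMM.ContinuityRadius (𝒳 : PMM) (r : ℝ) : Prop :=
  0 < r ∧ Metric.closedBall 𝒳.basepoint r = closure (Metric.ball 𝒳.basepoint r) ∧
    𝒳.meas (Metric.closedBall 𝒳.basepoint r \ Metric.ball 𝒳.basepoint r) = 0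

/-- Ultrafilter limit of a dominated family of measures, converging setwise. -/
theorem exists_ultralimit {α : Type*} [MeasurableSpace α] (U : Ultrafilter ℕ) (μ : Measure α)
    (hμ : μ Set.univ ≠ ⊤) (m : ℕ → Measure α) (hm : ∀ n, m n ≤ μ) :
    ∃ ν : Measure α, ν ≤ μ ∧ ∀ A, MeasurableSet A →
      Tendsto (fun n => m n A) (U : Filter ℕ) (𝓝 (ν A)) := by
  have hμ' : ∀ A, μ A ≠ ⊤ := fun A => ne_top_of_le_ne_top hμ (measure_mono (Set.subset_univ A))
  have hm' : ∀ n A, m n A ≠ ⊤ := fun n A => ne_top_of_le_ne_top (hμ' A) (hm n A)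
  have hex : ∀ A : Set α, ∃ v, Tendsto (fun n => m n A) (U : Filter ℕ) (𝓝 v) := fun A =>
    ⟨_, (U.map (fun n => m n A)).le_nhds_lim⟩
  choose v hv using hex
  have hvle : ∀ A, v A ≤ μ A := fun A =>
    le_of_tendsto (hv A) (Eventually.of_forall fun n => hm n A)
  have hv' : ∀ A, v A ≠ ⊤ := fun A => ne_top_of_le_ne_top (hμ' A) (hvle A)
  have h0 : v ∅ = 0 := le_antisymm ((hvle ∅).trans (by simp)) bot_le
  have hadd : ∀ ⦃f : ℕ → Set α⦄, (∀ i, MeasurableSet (f i)) → Pairwise (Function.onFun Disjoint f) →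
      v (⋃ i, f i) = ∑' i, v (f i) := by
    intro f hf hd
    have hsumμ : ∑' i, μ (f i) ≠ ⊤ := by
      rw [← measure_iUnion hd hf]; exact hμ' _
    have hsumv : ∑' i, v (f i) ≠ ⊤ :=
      ne_top_of_le_ne_top hsumμ (ENNReal.tsum_le_tsum fun i => hvle _)
    have key : Tendsto (fun n => ∑' i, (m n (f i)).toReal) (U : Filter ℕ)
        (𝓝 (∑' i, (v (f i)).toReal)) := by
      refine tendsto_tsum_of_dominated_convergence (ENNReal.summable_toReal hsumμ) ?_ ?_
      · intro k
        exact (ENNReal.tendsto_toReal (hv' _)).comp (hv _)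
      · refine Eventually.of_forall fun n k => ?_
        rw [Real.norm_of_nonneg ENNReal.toReal_nonneg]
        exact ENNReal.toReal_mono (hμ' _) (hm n _)
    have key2 : Tendsto (fun n => (m n (⋃ i, f i)).toReal) (U : Filter ℕ)
        (𝓝 (v (⋃ i, f i)).toReal) := (ENNReal.tendsto_toReal (hv' _)).comp (hv _)
    have e : ∀ n, (m n (⋃ i, f i)).toReal = ∑' i, (m n (f i)).toReal := fun n => by
      rw [measure_iUnion hd hf, ENNReal.tsum_toReal_eq (fun i => hm' n _)]
    simp only [e] at key2
    have := tendsto_nhds_unique key2 key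
    rw [← ENNReal.tsum_toReal_eq (fun i => hv' _)] at this
    exact (ENNReal.toReal_eq_toReal_iff' (hv' _) hsumv).1 this
  let ν : Measure α := Measure.ofMeasurable (fun A _ => v A) h0 hadd
  have hν : ∀ A, MeasurableSet A → ν A = v A := fun A hA => Measure.ofMeasurable_apply A hA
  refine ⟨ν, Measure.le_iff.2 fun A hA => (hν A hA).le.trans (hvle A), fun A hA => ?_⟩
  rw [hν A hA]; exact hv A

/-- Setwise convergence gives convergence in the Prokhorov distance on a compact space. -/
theorem eventually_prokhorov {α : Type*} [MetricSpace α] [CompactSpace α] [MeasurableSpace α]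
    [BorelSpace α] (l : Filter ℕ) (m : ℕ → Measure α) (ν : Measure α) (hν : ∀ A, ν A ≠ ⊤)
    (h : ∀ A, MeasurableSet A → Tendsto (fun n => m n A) l (𝓝 (ν A)))
    (ε : ℝ) (hε : 0 < ε) : ∀ᶠ n in l, prokhorovDist (m n) ν ≤ ε := by
  obtain ⟨t, -, htf, ht⟩ := finite_cover_balls_of_compact (isCompact_univ (X := α)) (half_pos hε)
  have hε' : (0 : ENNReal) < ENNReal.ofReal ε := ENNReal.ofReal_pos.2 hε
  have hev : ∀ᶠ n in l, ∀ J ∈ {J : Set α | J ⊆ t},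
      m n (⋃ x ∈ J, Metric.ball x (ε / 2)) ∈
        Set.Icc (ν (⋃ x ∈ J, Metric.ball x (ε / 2)) - ENNReal.ofReal ε)
          (ν (⋃ x ∈ J, Metric.ball x (ε / 2)) + ENNReal.ofReal ε) := by
    rw [eventually_all_finite htf.finite_subsets]
    intro J hJ
    refine (ENNReal.tendsto_nhds (hν _)).1 (h _ ?_) _ hε'
    exact (isOpen_biUnion fun x _ => Metric.isOpen_ball).measurableSet
  filter_upwards [hev] with n hn
  refine csInf_le ⟨0, fun x hx => hx.1.le⟩ ⟨hε, fun A _ => ?_⟩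
  set J : Set α := {x ∈ t | (A ∩ Metric.ball x (ε / 2)).Nonempty} with hJ
  have h1 : A ⊆ ⋃ x ∈ J, Metric.ball x (ε / 2) := by
    intro a ha
    obtain ⟨x, hx, hax⟩ := Set.mem_iUnion₂.1 (ht (Set.mem_univ a))
    exact Set.mem_iUnion₂.2 ⟨x, ⟨hx, a, ha, hax⟩, hax⟩
  have h2 : (⋃ x ∈ J, Metric.ball x (ε / 2)) ⊆ Metric.cthickening ε A := by
    intro y hy
    obtain ⟨x, ⟨hx, a, ha, hax⟩, hyx⟩ := Set.mem_iUnion₂.1 hy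
    refine Metric.mem_cthickening_of_dist_le y a ε A ha ?_
    have := dist_triangle_right y a x
    rw [Metric.mem_ball] at hax hyx
    linarith
  obtain ⟨h3, h4⟩ := hn J (fun x hx => hx.1)
  constructor
  · exact (measure_mono h1).trans (h4.trans (by gcongr))
  · exact (measure_mono h1).trans ((tsub_le_iff_right.1 h3).trans (by gcongr))

theorem map_comap_val_aux {α : Type*} [MeasurableSpace α] (s : Set α) (hs : MeasurableSet s)
    (μ : Measure α) (h0 : μ sᶜ = 0) (m' : MeasurableSpace s)
    (hm' : m' = Subtype.instMeasurableSpace) :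
    @Measure.map s α m' _ Subtype.val (@Measure.comap s α m' _ Subtype.val μ) = μ := by
  subst hm'
  rw [map_comap_subtype_coe hs]
  exact Measure.restrict_eq_self_of_ae_mem (by rwa [ae_iff])

theorem cGHP_nonneg (𝒳 𝒴 : PMM) : 0 ≤ cGHP 𝒳 𝒴 := by
  refine Real.sInf_nonneg ?_
  rintro x ⟨e, -, rfl⟩
  exact le_max_of_le_left dist_nonneg

theorem cGHP_sub_le {𝒳 : PMM} (S T : SubPMM 𝒳) (hS : IsCompact S.set) (hT : IsCompact T.set)
    (ε : ℝ) (hε : 0 ≤ ε) (hH : Metric.hausdorffDist S.set T.set ≤ ε)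
    (hP : prokhorovDist S.meas T.meas ≤ ε) : cGHP S.toPMM T.toPMM ≤ ε := by
  let e : GHPEmbedding S.toPMM T.toPMM :=
    { Z := 𝒳.carrier, mZ := inferInstance,
      f := fun x : S.set => x.1, g := fun x : T.set => x.1 }
  have hle : cGHP S.toPMM T.toPMM ≤ e.value := by
    refine csInf_le ⟨0, ?_⟩ ⟨e, ⟨isometry_subtype_coe (s := S.set),
      isometry_subtype_coe (s := T.set)⟩, rfl⟩
    rintro x ⟨e, -, rfl⟩
    exact le_max_of_le_left dist_nonneg
  refine hle.trans (max_le ?_ (max_le ?_ ?_))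
  · exact (dist_self 𝒳.basepoint).le.trans hε
  · have h1 : Set.range e.f = S.set := Subtype.range_coe
    have h2 : Set.range e.g = T.set := Subtype.range_coe
    rw [h1, h2]; exact hH
  · have h1 := map_comap_val_aux S.set hS.isClosed.measurableSet S.meas S.supported (borel S.set)
      (Subtype.borelSpace S.set).measurable_eq.symm
    have h2 := map_comap_val_aux T.set hT.isClosed.measurableSet T.meas T.supported (borel T.set)
      (Subtype.borelSpace T.set).measurable_eq.symm
    rw [← h1, ← h2] at hP
    exact hP

/-- If `𝒳` is a compact pmm space, the collection of its compact pmm-subspaces is compact in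
the topology of `dc`: every sequence of compact pmm-subspaces of `𝒳` has a subsequence
converging in `dc` to a compact pmm-subspace of `𝒳`. -/
theorem subPMM_compact (𝒳 : PMM) (h𝒳 : 𝒳.IsCompactPMM)
    (S : ℕ → SubPMM 𝒳) (hS : ∀ n, (S n).IsCompactSub) :
    ∃ (φ : ℕ → ℕ) (Y : SubPMM 𝒳), StrictMono φ ∧ Y.IsCompactSub ∧
      Tendsto (fun n => cGHP ((S (φ n)).toPMM) Y.toPMM) atTop (𝓝 0) := by
  obtain ⟨hc, hfin⟩ := h𝒳
  let U : Ultrafilter ℕ := Filter.hyperfilter ℕ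
  have hU : (U : Filter ℕ) ≤ atTop := Nat.hyperfilter_le_atTop
  let K : ℕ → TopologicalSpace.NonemptyCompacts 𝒳.carrier := fun n =>
    ⟨⟨(S n).set, (hS n).1⟩, ⟨_, (S n).root_mem⟩⟩
  obtain ⟨L, hL⟩ : ∃ L, Tendsto K (U : Filter ℕ) (𝓝 L) :=
    haveI : Nonempty (TopologicalSpace.NonemptyCompacts 𝒳.carrier) := ⟨K 0⟩
    ⟨_, (U.map K).le_nhds_lim⟩
  have hH : ∀ ε > 0, ∀ᶠ n in (U : Filter ℕ),
      Metric.hausdorffDist (S n).set (L : Set 𝒳.carrier) < ε := by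
    intro ε hε
    filter_upwards [Metric.tendsto_nhds.1 hL ε hε] with n hn
    rw [Metric.NonemptyCompacts.dist_eq] at hn
    exact hn
  have hLcl : IsClosed (L : Set 𝒳.carrier) := L.isCompact.isClosed
  have hsub : ∀ ε > 0, ∀ᶠ n in (U : Filter ℕ),
      (S n).set ⊆ Metric.cthickening ε (L : Set 𝒳.carrier) := by
    intro ε hε
    filter_upwards [hH ε hε] with n hn x hx
    obtain ⟨y, hy, hxy⟩ := Metric.exists_dist_lt_of_hausdorffDist_lt hx hn
      (Metric.hausdorffEDist_ne_top_of_nonempty_of_bounded ⟨_, hx⟩ L.nonempty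
        (hS n).1.isBounded L.isCompact.isBounded)
    exact Metric.mem_cthickening_of_dist_le x y ε _ hy hxy.le
  have hLI : (L : Set 𝒳.carrier) = ⋂ k : ℕ, Metric.cthickening (1 / ((k : ℝ) + 1)) L := by
    refine Set.Subset.antisymm (Set.subset_iInter fun k => Metric.self_subset_cthickening _) ?_
    intro x hx
    rw [← hLcl.closure_eq, Metric.closure_eq_iInter_cthickening]
    refine Set.mem_iInter₂.2 fun δ hδ => ?_
    obtain ⟨k, hk⟩ := exists_nat_one_div_lt hδ
    exact Metric.cthickening_mono hk.le _ (Set.mem_iInter.1 hx k)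
  obtain ⟨ν, hνle, hν⟩ := exists_ultralimit U 𝒳.meas hfin (fun n => (S n).meas)
    (fun n => (S n).meas_le)
  have hνfin : ∀ A, ν A ≠ ⊤ := fun A => ne_top_of_le_ne_top hfin
    ((hνle A).trans (measure_mono (Set.subset_univ A)))
  have hroot : 𝒳.basepoint ∈ (L : Set 𝒳.carrier) := by
    rw [hLI]
    refine Set.mem_iInter.2 fun k => ?_
    obtain ⟨n, hn⟩ := (hsub (1 / ((k : ℝ) + 1)) Nat.one_div_pos_of_nat).exists
    exact hn (S n).root_mem
  have hsupp : ν (L : Set 𝒳.carrier)ᶜ = 0 := by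
    rw [hLI, Set.compl_iInter, measure_iUnion_null_iff]
    intro k
    refine tendsto_nhds_unique
      (hν _ Metric.isClosed_cthickening.measurableSet.compl) (tendsto_const_nhds.congr' ?_)
    filter_upwards [hsub (1 / ((k : ℝ) + 1)) Nat.one_div_pos_of_nat] with n hn
    exact (measure_mono_null (Set.compl_subset_compl.2 hn) (S n).supported).symm
  let Y : SubPMM 𝒳 := ⟨L, hroot, ν, hνle, hsupp⟩
  have hfreq : ∀ k : ℕ, ∃ᶠ n in atTop, cGHP (S n).toPMM Y.toPMM ≤ 1 / ((k : ℝ) + 1) := by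
    intro k
    have hk : (0 : ℝ) < 1 / ((k : ℝ) + 1) := Nat.one_div_pos_of_nat
    have : ∀ᶠ n in (U : Filter ℕ), cGHP (S n).toPMM Y.toPMM ≤ 1 / ((k : ℝ) + 1) := by
      filter_upwards [hH _ hk, eventually_prokhorov (U : Filter ℕ) (fun n => (S n).meas) ν hνfin
        hν _ hk] with n h1 h2
      exact cGHP_sub_le (S n) Y (hS n).1 L.isCompact _ hk.le h1.le h2
    exact this.frequently.filter_mono hU
  obtain ⟨φ, hφ, hφ'⟩ := extraction_forall_of_frequently hfreq
  refine ⟨φ, Y, hφ, ⟨L.isCompact, hνfin _⟩, ?_⟩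
  exact squeeze_zero (fun n => cGHP_nonneg _ _) hφ' tendsto_one_div_add_atTop_nhds_zero_nat

end
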